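/- Let N be an abelian group, H a finite abelian group, and A₀ ≤ A₁ ≤ A₂ ≤ ⋯ an increasing chain of subgroups of N such that for every k the subgroup A_k is isomorphic to H^k (a direct sum of k copies of H) and A_k is a direct summand of N. Then the union A = ⋃_k A_k is a direct summand of N, and A is isomorphic to ⨁_ℕ H. -/

import Mathlib

universe u1 u2 u3

open Classical in
theorem card_homs_fiber {X G : Type*} [AddCommGroup X] [AddCommGroup G] [Finite X] [Finite G] :
    Nat.card (X →+ G) = ∑ᶠ K : AddSubgroup X, Nat.card {f : X →+ G // f.ker = K} := by
  have : Finite (X →+ G) := DFunLike.finite _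
  have : Fintype (AddSubgroup X) := Fintype.ofFinite _
  rw [finsum_eq_sum_of_fintype, ← Nat.card_sigma]
  exact Nat.card_congr (Equiv.sigmaFiberEquiv (fun f : X →+ G => f.ker)).symm

theorem card_fiber_quot {X G : Type*} [AddCommGroup X] [AddCommGroup G] (K : AddSubgroup X) :
    Nat.card {f : X →+ G // f.ker = K} = Nat.card {f : X ⧸ K →+ G // f.ker = ⊥} := by
  refine Nat.card_congr (Equiv.ofBijective (fun f => ⟨QuotientAddGroup.lift K f.1 (by rw [f.2]), ?_⟩) ⟨?_, ?_⟩)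
  · rw [AddMonoidHom.ker_eq_bot_iff]
    rw [injective_iff_map_eq_zero]
    intro a
    induction a using QuotientAddGroup.induction_on with
    | H z =>
      intro h
      rw [QuotientAddGroup.eq_zero_iff, ← f.2]
      exact h
  · intro f g h
    ext x
    have := congrArg (fun t => t.1 (x : X ⧸ K)) h
    simpa using this
  · intro f
    refine ⟨⟨f.1.comp (QuotientAddGroup.mk' K), ?_⟩, ?_⟩
    · ext x
      have := (AddMonoidHom.ker_eq_bot_iff _).1 f.2
      rw [injective_iff_map_eq_zero] at this
      rw [AddMonoidHom.mem_ker, ← QuotientAddGroup.eq_zero_iff]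
      constructor
      · exact this _
      · intro h
        simp [h]
    · ext x
      rfl

theorem card_inj_eq {G : Type u1} {H : Type u2} [AddCommGroup G] [AddCommGroup H] [Finite G] [Finite H]
    (n : ℕ) : ∀ (X : Type u3) [AddCommGroup X] [Finite X]
    (_ : ∀ (Y : Type u3) [AddCommGroup Y] [Finite Y], Nat.card (Y →+ G) = Nat.card (Y →+ H)),
    Nat.card X = n →
    Nat.card {f : X →+ G // f.ker = ⊥} = Nat.card {f : X →+ H // f.ker = ⊥} := by
  induction n using Nat.strong_induction_on with
  | _ n ih =>
    intro X _ _ hY hn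
    have : Fintype (AddSubgroup X) := Fintype.ofFinite _
    classical
    have h := hY X
    rw [card_homs_fiber, card_homs_fiber, finsum_eq_sum_of_fintype, finsum_eq_sum_of_fintype,
      ← Finset.add_sum_erase _ _ (Finset.mem_univ ⊥), ← Finset.add_sum_erase _ _ (Finset.mem_univ ⊥)] at h
    have h2 : ∑ K ∈ Finset.univ.erase (⊥ : AddSubgroup X), Nat.card {f : X →+ G // f.ker = K}
       = ∑ K ∈ Finset.univ.erase (⊥ : AddSubgroup X), Nat.card {f : X →+ H // f.ker = K} := by
      refine Finset.sum_congr rfl fun K hK => ?_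
      rw [card_fiber_quot (G := G) K, card_fiber_quot (G := H) K]
      refine ih _ ?_ (X ⧸ K) hY rfl
      have hK : K ≠ ⊥ := (Finset.mem_erase.1 hK).1
      have h1 := AddSubgroup.card_eq_card_quotient_mul_card_addSubgroup K
      have h3 : 1 < Nat.card K := by
        rw [AddSubgroup.one_lt_card_iff_ne_bot]; exact hK
      have : 0 < Nat.card (X ⧸ K) := Nat.card_pos
      rw [← hn, h1]
      nlinarith
    omega

theorem cancel_iso {B : Type u1} {C : Type u2} {H : Type u3} [AddCommGroup B] [AddCommGroup C] [AddCommGroup H]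
    [Finite B] [Finite C] [Finite H] (e : (B × C) ≃+ (B × H)) : Nonempty (C ≃+ H) := by
  have hc : ∀ (Y : Type u2) [AddCommGroup Y] [Finite Y], Nat.card (Y →+ C) = Nat.card (Y →+ H) := by
    intro Y _ _
    have : Finite (Y →+ B) := DFunLike.finite _
    have key : ∀ {D : Type u2} [AddCommGroup D], Nat.card (Y →+ B × D) = Nat.card (Y →+ B) * Nat.card (Y →+ D) := by
      intro D _
      rw [← Nat.card_prod]
      exact Nat.card_congr ⟨fun f => ⟨(AddMonoidHom.fst B D).comp f, (AddMonoidHom.snd B D).comp f⟩,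
        fun f => f.1.prod f.2, fun f => rfl, fun f => rfl⟩
    have key' : ∀ {D : Type u3} [AddCommGroup D], Nat.card (Y →+ B × D) = Nat.card (Y →+ B) * Nat.card (Y →+ D) := by
      intro D _
      rw [← Nat.card_prod]
      exact Nat.card_congr ⟨fun f => ⟨(AddMonoidHom.fst B D).comp f, (AddMonoidHom.snd B D).comp f⟩,
        fun f => f.1.prod f.2, fun f => rfl, fun f => rfl⟩
    have h1 : Nat.card (Y →+ B × C) = Nat.card (Y →+ B × H) :=
      Nat.card_congr ⟨fun f => e.toAddMonoidHom.comp f, fun f => e.symm.toAddMonoidHom.comp f,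
        fun f => by ext <;> simp, fun f => by ext <;> simp⟩
    rw [key, key'] at h1
    exact Nat.eq_of_mul_eq_mul_left Nat.card_pos h1
  have h := card_inj_eq (G := C) (H := H) _ C hc rfl
  have : Finite (C →+ C) := DFunLike.finite _
  have : Finite (C →+ H) := DFunLike.finite _
  have hp : 0 < Nat.card {f : C →+ C // f.ker = ⊥} := by
    have : Nonempty {f : C →+ C // f.ker = ⊥} := ⟨⟨AddMonoidHom.id C, by ext; simp⟩⟩
    exact Nat.card_pos
  rw [h] at hp
  obtain ⟨⟨f, hf⟩⟩ := (Nat.card_pos_iff.1 hp).1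
  have hinj := (AddMonoidHom.ker_eq_bot_iff _).1 hf
  have hcard : Nat.card C = Nat.card H := by
    have := Nat.card_congr e.toEquiv
    rw [Nat.card_prod, Nat.card_prod] at this
    exact Nat.eq_of_mul_eq_mul_left Nat.card_pos this
  exact ⟨AddEquiv.ofBijective f ((Nat.bijective_iff_injective_and_card f).2 ⟨hinj, hcard⟩)⟩

theorem zmod_dvd (n : ℕ) (hn : n ≠ 0) (d z : ZMod n) (h : ∀ r : ZMod n, r * d = 0 → r * z = 0) : ∃ w, d * w = z := by
  obtain ⟨D, rfl⟩ := ZMod.intCast_surjective d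
  obtain ⟨Z, rfl⟩ := ZMod.intCast_surjective z
  obtain ⟨t, ht⟩ := Int.gcd_dvd_left D n
  obtain ⟨s, hs⟩ := Int.gcd_dvd_right D n
  have hb := Int.gcd_eq_gcd_ab D n
  set g : ℤ := (Int.gcd D n : ℤ)
  have hs0 : s ≠ 0 := by
    rintro rfl
    simp at hs; omega
  have h1 := h (s : ℤ) (by
    rw [← Int.cast_mul, ZMod.intCast_zmod_eq_zero_iff_dvd]
    exact ⟨t, by rw [hs]; nth_rw 1 [ht]; ring⟩)
  rw [← Int.cast_mul, ZMod.intCast_zmod_eq_zero_iff_dvd] at h1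
  obtain ⟨u, hu⟩ := h1
  have hz : Z = g * u := by
    apply mul_left_cancel₀ hs0
    rw [hu]; nth_rw 1 [hs]; ring
  refine ⟨((Int.gcdA D n * u : ℤ) : ZMod n), ?_⟩
  rw [hz, hb]
  push_cast
  simp
  ring

theorem zmod_baer (n : ℕ) (hn : n ≠ 0) : Module.Baer (ZMod n) (ℕ →₀ ZMod n) := by
  intro I g
  have : IsPrincipalIdealRing (ZMod n) :=
    IsPrincipalIdealRing.of_surjective (Int.castRingHom (ZMod n)) ZMod.intCast_surjective
  obtain ⟨d, rfl⟩ := (IsPrincipalIdealRing.principal I).principal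
  have hd : d ∈ Submodule.span (ZMod n) {d} := Submodule.mem_span_singleton_self d
  have hx : ∀ r : ZMod n, r * d = 0 → r • g ⟨d, hd⟩ = 0 := by
    intro r hr
    rw [← map_smul]
    convert map_zero g
    exact Subtype.ext hr
  have hy : ∀ j, ∃ w, d * w = g ⟨d, hd⟩ j := fun j => zmod_dvd n hn _ _ fun r hr => by
    have := DFunLike.congr_fun (hx r hr) j
    simpa using this
  choose w hw using hy
  classical
  let y : ℕ →₀ ZMod n := Finsupp.onFinset (g ⟨d, hd⟩).support
    (fun j => if g ⟨d, hd⟩ j = 0 then 0 else w j) (by intro j; simp; tauto)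
  have hdy : d • y = g ⟨d, hd⟩ := by
    ext j
    simp only [y, Finsupp.smul_apply, Finsupp.onFinset_apply, smul_eq_mul]
    split_ifs with h
    · simp [h]
    · exact hw j
  refine ⟨LinearMap.toSpanSingleton (ZMod n) _ y, ?_⟩
  intro x hx
  obtain ⟨a, rfl⟩ := Submodule.mem_span_singleton.1 hx
  rw [LinearMap.toSpanSingleton_apply, smul_assoc, hdy, ← map_smul]
  rfl

theorem zmod_retr (n : ℕ) (hn : n ≠ 0) :
    ∃ r : (ℕ → ZMod n) →+ (ℕ →₀ ZMod n), ∀ f : ℕ →₀ ZMod n, r f = f := by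
  obtain ⟨h, hh⟩ := (zmod_baer n hn).extension_property (M := ℕ →₀ ZMod n) (N := ℕ → ZMod n)
    (Finsupp.lcoeFun) (fun a b h => DFunLike.coe_injective h) LinearMap.id
  exact ⟨h.toAddMonoidHom, fun f => LinearMap.congr_fun hh f⟩

theorem retr (H : Type*) [AddCommGroup H] [Finite H] :
    ∃ r : (ℕ → H) →+ (ℕ →₀ H), ∀ f : ℕ →₀ H, r f = f := by
  classical
  obtain ⟨ι, _, n, hn, ⟨e⟩⟩ := AddCommGroup.equiv_directSum_zmod_of_finite' H
  choose r hr using fun i => zmod_retr (n i) (by have := hn i; omega)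
  let p : ∀ i, H →+ ZMod (n i) := fun i => (DFinsupp.evalAddMonoidHom i).comp e.toAddMonoidHom
  let q : ∀ i, ZMod (n i) →+ H := fun i => e.symm.toAddMonoidHom.comp (DirectSum.of (fun i => ZMod (n i)) i)
  have hpq : ∀ x, ∑ i, q i (p i x) = x := by
    intro x
    have := DirectSum.sum_univ_of (e x)
    apply e.injective
    rw [map_sum, ← this]
    refine Finset.sum_congr rfl fun i _ => ?_
    simp only [p, q]
    simp [this]
    rfl
  refine ⟨∑ i, (Finsupp.mapRange.addMonoidHom (q i)).comp ((r i).comp ((p i).compLeft ℕ)), ?_⟩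
  intro f
  have : ∀ i, r i ((p i).compLeft ℕ f) = Finsupp.mapRange.addMonoidHom (p i) f := by
    intro i
    rw [← hr i (Finsupp.mapRange.addMonoidHom (p i) f)]
    rfl
  simp only [AddMonoidHom.finsetSum_apply, AddMonoidHom.comp_apply, this]
  ext k
  rw [Finsupp.finsetSum_apply]
  exact hpq (f k)

theorem compat_retr {N : Type*} [AddCommGroup N] (A : ℕ → AddSubgroup N) (hmono : Monotone A)
    (hsummand : ∀ k : ℕ, ∃ ρ : N →+ N, (∀ x : N, ρ x ∈ A k) ∧ ∀ a ∈ A k, ρ a = a) :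
    ∃ σ : ℕ → N →+ N, (∀ k x, σ k x ∈ A k) ∧ (∀ k, ∀ a ∈ A k, σ k a = a) ∧
      ∀ k x, σ k (σ (k + 1) x) = σ k x := by
  choose ρ h1 h2 using hsummand
  let T : ℕ → Type _ := fun k => {σ : N →+ N // (∀ x, σ x ∈ A k) ∧ ∀ a ∈ A k, σ a = a}
  let step : ∀ k, T k → T (k + 1) := fun k s =>
    ⟨s.1 + (AddMonoidHom.id N - s.1).comp ((ρ (k + 1)).comp (AddMonoidHom.id N - s.1)), by
      have hk : A k ≤ A (k + 1) := hmono (Nat.le_succ k)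
      constructor
      · intro x
        exact add_mem (hk (s.2.1 _)) (sub_mem (h1 _ _) (hk (s.2.1 _)))
      · intro a ha
        have h3 : ρ (k + 1) (a - s.1 a) = a - s.1 a := h2 _ _ (sub_mem ha (hk (s.2.1 _)))
        have h4 : s.1 (s.1 a) = s.1 a := s.2.2 _ (s.2.1 _)
        simp only [AddMonoidHom.add_apply, AddMonoidHom.comp_apply, AddMonoidHom.sub_apply,
          AddMonoidHom.id_apply, h3]
        rw [map_sub, h4]
        abel⟩
  let S : ∀ k, T k := fun k => Nat.rec (motive := T) ⟨ρ 0, h1 0, h2 0⟩ step k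
  refine ⟨fun k => (S k).1, fun k => (S k).2.1, fun k => (S k).2.2, fun k x => ?_⟩
  change (S k).1 ((step k (S k)).1 x) = _
  have h4 : ∀ y, (S k).1 ((S k).1 y) = (S k).1 y := fun y => (S k).2.2 _ ((S k).2.1 _)
  simp only [step, AddMonoidHom.add_apply, AddMonoidHom.comp_apply, AddMonoidHom.sub_apply,
          AddMonoidHom.id_apply, map_add, map_sub, h4]
  abel

/-- **Final iteration in the proof of Theorem B.** If `A₀ ≤ A₁ ≤ A₂ ≤ ⋯` is an increasing
chain of subgroups of `N` with each `A k` isomorphic to `H^k` (here `Fin k → H`) and each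
`A k` a direct summand of `N`, then the union `⨆ k, A k` is a direct summand of `N` and is
isomorphic to `⨁_ℕ H` (encoded as `ℕ →₀ H`). -/
theorem chain_of_summands_union
    (N : Type*) [AddCommGroup N]
    (H : Type*) [AddCommGroup H] [Finite H]
    (A : ℕ → AddSubgroup N) (hmono : Monotone A)
    (hiso : ∀ k : ℕ, Nonempty (A k ≃+ (Fin k → H)))
    (hsummand : ∀ k : ℕ, ∃ ρ : N →+ N, (∀ x : N, ρ x ∈ A k) ∧ ∀ a ∈ A k, ρ a = a) :
    (∃ ρ : N →+ N, (∀ x : N, ρ x ∈ ⨆ k, A k) ∧ ∀ a ∈ ⨆ k, A k, ρ a = a) ∧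
      Nonempty ((⨆ k, A k : AddSubgroup N) ≃+ (ℕ →₀ H)) := by
  obtain ⟨σ, h1, h2, h3⟩ := compat_retr A hmono hsummand
  have hle : ∀ j k, j ≤ k → ∀ x, σ j (σ k x) = σ j x := by
    intro j k hjk
    induction k, hjk using Nat.le_induction with
    | base => exact fun x => h2 _ _ (h1 _ _)
    | succ k hk ih =>
      intro x
      rw [← ih, h3, ih]
  let C : ℕ → AddSubgroup N := fun k => A (k + 1) ⊓ (σ k).ker
  have hkk : ∀ k, A k ≤ A (k + 1) := fun k => hmono (Nat.le_succ k)
  have hfin : ∀ k, Finite (A k) := fun k => Finite.of_equiv _ (hiso k).some.symm.toEquiv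
  have hC : ∀ k, Nonempty (C k ≃+ H) := by
    intro k
    have : Finite (A (k + 1)) := hfin _
    have : Finite (A k) := hfin _
    have : Finite (C k) := Finite.of_injective
      (AddSubgroup.inclusion (inf_le_left : C k ≤ A (k + 1))) (AddSubgroup.inclusion_injective _)
    let e1 : (A k × C k) ≃+ A (k + 1) :=
      { toFun := fun p => ⟨p.1 + p.2, add_mem (hkk k p.1.2) p.2.2.1⟩
        invFun := fun x => (⟨σ k x, h1 _ _⟩, ⟨x - σ k x, AddSubgroup.mem_inf.2 ⟨sub_mem x.2 (hkk k (h1 _ _)), by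
          rw [AddMonoidHom.mem_ker, map_sub, h2 _ _ (h1 _ _), sub_self]⟩⟩)
        left_inv := by
          rintro ⟨⟨a, ha⟩, ⟨c, hc, hc'⟩⟩
          have h : σ k (a + c) = a := by
            rw [map_add, h2 _ _ ha, (AddMonoidHom.mem_ker).1 hc', add_zero]
          refine Prod.ext (Subtype.ext h) (Subtype.ext ?_)
          change a + c - σ k (a + c) = c
          rw [h]; abel
        right_inv := by
          rintro ⟨x, hx⟩
          apply Subtype.ext
          change σ k x + (x - σ k x) = x
          abel
        map_add' := by
          rintro ⟨a, c⟩ ⟨a', c'⟩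
          apply Subtype.ext
          change ((a : N) + a') + (c + c') = (a + c) + (a' + c')
          abel }
    let e2 : (Fin (k + 1) → H) ≃+ ((Fin k → H) × H) :=
      { toFun := fun f => (fun i => f i.succ, f 0)
        invFun := fun p => Fin.cons p.2 p.1
        left_inv := fun f => by
          ext i
          refine Fin.cases ?_ (fun i => ?_) i <;> simp
        right_inv := fun p => by simp
        map_add' := fun f g => rfl }
    exact cancel_iso (((e1.trans (hiso (k + 1)).some).trans e2).trans
      (AddEquiv.prodCongr (hiso k).some.symm (AddEquiv.refl H)))
  let e : ∀ k, C k ≃+ H := fun k => (hC k).some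
  have hd : ∀ k x, (σ (k + 1) - σ k) x ∈ C k := by
    intro k x
    refine AddSubgroup.mem_inf.2 ⟨sub_mem (h1 _ _) (hkk k (h1 _ _)), ?_⟩
    rw [AddMonoidHom.mem_ker, AddMonoidHom.sub_apply, map_sub, h3, h2 _ _ (h1 _ _), sub_self]
  let φ : ∀ k, N →+ H := fun k =>
    (e k).toAddMonoidHom.comp ((σ (k + 1) - σ k).codRestrict (C k) (hd k))
  let Φ : N →+ (ℕ → H) := AddMonoidHom.mk' (fun x k => φ k x) (by
    intro a b; ext k; exact map_add _ _ _)
  let ψ : ∀ k, H →+ N := fun k => (C k).subtype.comp (e k).symm.toAddMonoidHom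
  let Ψ : (ℕ →₀ H) →+ N := Finsupp.liftAddHom ψ
  have hψφ : ∀ k x, ψ k (φ k x) = σ (k + 1) x - σ k x := by
    intro k x
    simp [ψ, φ]
  have hσ0 : ∀ x, σ 0 x = 0 := by
    intro x
    have : Subsingleton (A 0) := (hiso 0).some.toEquiv.subsingleton
    have h := Subsingleton.elim (⟨σ 0 x, h1 0 x⟩ : A 0) 0
    exact congrArg Subtype.val h
  have hψmem : ∀ k h, ψ k h ∈ C k := fun k h => ((e k).symm h).2
  have hψA : ∀ k h, ψ k h ∈ A (k + 1) := fun k h => (hψmem k h).1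
  have hψσ : ∀ k h, σ k (ψ k h) = 0 := fun k h => (hψmem k h).2
  have hψinj : ∀ k, Function.Injective (ψ k) := fun k =>
    Subtype.val_injective.comp (e k).symm.injective
  have hφψ : ∀ k j h, φ k (ψ j h) = if j = k then h else 0 := by
    intro k j h
    apply hψinj k
    rw [hψφ]
    rcases lt_trichotomy j k with hjk | rfl | hjk
    · have hm := hψA j h
      rw [h2 k _ (hmono hjk hm), h2 (k + 1) _ (hmono (by omega) hm), if_neg hjk.ne]
      simp
    · rw [h2 _ _ (hψA j h), hψσ]
      simp
    · rw [if_neg hjk.ne', ← hle k j hjk.le, ← hle (k + 1) j hjk, hψσ]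
      simp
  have hΦΨ : ∀ f, Φ (Ψ f) = f := by
    intro f
    induction f using Finsupp.induction_linear with
    | zero => simp
    | add f g hf hg => rw [map_add, map_add, hf, hg]; rfl
    | single j h =>
      ext k
      have : Ψ (Finsupp.single j h) = ψ j h := by simp [Ψ]
      rw [this]
      change φ k (ψ j h) = _
      rw [hφψ, Finsupp.single_apply]
  have hΨinj : Function.Injective Ψ := by
    intro f g hfg
    apply DFunLike.coe_injective
    rw [← hΦΨ f, ← hΦΨ g, hfg]
  have hsum : ∀ k x, σ k x ∈ Ψ.range := by
    intro k x
    induction k with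
    | zero => rw [hσ0]; exact zero_mem _
    | succ k ih =>
      have : σ (k + 1) x = ψ k (φ k x) + σ k x := by rw [hψφ]; abel
      rw [this]
      exact add_mem ⟨Finsupp.single k (φ k x), by simp [Ψ]⟩ ih
  have hrange : (⨆ k, A k) = Ψ.range := by
    apply le_antisymm
    · refine iSup_le fun k a ha => ?_
      rw [← h2 k a ha]
      exact hsum k a
    · rintro _ ⟨f, rfl⟩
      induction f using Finsupp.induction_linear with
      | zero => simp
      | add f g hf hg => rw [map_add]; exact add_mem hf hg
      | single j h =>
        have : Ψ (Finsupp.single j h) = ψ j h := by simp [Ψ]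
        rw [this]
        exact le_iSup A (j + 1) (hψA j h)
  rw [hrange]
  obtain ⟨r, hr⟩ := retr H
  refine ⟨⟨Ψ.comp (r.comp Φ), fun x => ⟨_, rfl⟩, ?_⟩, ⟨(AddMonoidHom.ofInjective hΨinj).symm⟩⟩
  rintro _ ⟨f, rfl⟩
  simp only [AddMonoidHom.comp_apply]
  rw [hΦΨ, hr]
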